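/- arXiv:1512.03518 — 3 statements merged into one kernel-verified Lean document; each statement's English description precedes it below -/
import Mathlib

section
/- Let Γ : E₁ ⇉ E₂ be a set-valued map between finite-dimensional real inner product spaces, let ū ∈ dom(Γ), and let V̄ ⊆ Γ(ū) be compact. Then the following are equivalent: (a) Γ is calm at ū for every v̄ ∈ V̄; (b) there exist constants κ, ε > 0 such that for every u ∈ E₁ and every v ∈ Γ(u) with d(v, V̄) ≤ ε, one has d(v, Γ(ū)) ≤ κ‖u − ū‖. -/
/-- A set-valued map `Γ : E₁ ⇉ E₂` is *calm* at `u₀` for `v₀` if `v₀ ∈ Γ u₀` and there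
are constants `κ, ε > 0` such that every `v ∈ Γ u` with `‖v - v₀‖ ≤ ε` satisfies
`d(v, Γ u₀) ≤ κ ‖u - u₀‖`. -/
def Calm {E₁ E₂ : Type*} [NormedAddCommGroup E₁] [NormedAddCommGroup E₂]
    (Γ : E₁ → Set E₂) (u₀ : E₁) (v₀ : E₂) : Prop :=
  v₀ ∈ Γ u₀ ∧ ∃ κ : ℝ, 0 < κ ∧ ∃ ε : ℝ, 0 < ε ∧
    ∀ u : E₁, ∀ v ∈ Γ u, ‖v - v₀‖ ≤ ε → Metric.infDist v (Γ u₀) ≤ κ * ‖u - u₀‖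

/-- For a set-valued map `Γ : E₁ ⇉ E₂`, a point `ū ∈ dom Γ`, and a
compact subset `V̄ ⊆ Γ ū`, the map `Γ` is calm at `ū` for every `v̄ ∈ V̄` iff there are
uniform constants `κ, ε > 0` such that every `v ∈ Γ u` within distance `ε` of `V̄`
satisfies `d(v, Γ ū) ≤ κ ‖u - ū‖`. -/
theorem calm_uniform_on_compact_fiber_subset
    {E₁ E₂ : Type*} [NormedAddCommGroup E₁] [InnerProductSpace ℝ E₁] [FiniteDimensional ℝ E₁]
    [NormedAddCommGroup E₂] [InnerProductSpace ℝ E₂] [FiniteDimensional ℝ E₂]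
    (Γ : E₁ → Set E₂) (ubar : E₁) (hdom : (Γ ubar).Nonempty)
    (Vbar : Set E₂) (hVsub : Vbar ⊆ Γ ubar) (hVcpt : IsCompact Vbar) :
    (∀ vbar ∈ Vbar, Calm Γ ubar vbar) ↔
      ∃ κ : ℝ, 0 < κ ∧ ∃ ε : ℝ, 0 < ε ∧
        ∀ u : E₁, ∀ v ∈ Γ u, (∃ w ∈ Vbar, ‖v - w‖ ≤ ε) →
          Metric.infDist v (Γ ubar) ≤ κ * ‖u - ubar‖ := by
  constructor
  · intro h
    refine hVcpt.induction_on
      (p := fun S => ∃ κ : ℝ, 0 < κ ∧ ∃ ε : ℝ, 0 < ε ∧ ∀ u : E₁, ∀ v ∈ Γ u,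
        (∃ w ∈ S, ‖v - w‖ ≤ ε) → Metric.infDist v (Γ ubar) ≤ κ * ‖u - ubar‖) ?_ ?_ ?_ ?_
    · exact ⟨1, one_pos, 1, one_pos, fun u v _ ⟨w, hw, _⟩ => hw.elim⟩
    · rintro S T hST ⟨κ, hκ, ε, hε, hT⟩
      exact ⟨κ, hκ, ε, hε, fun u v hv ⟨w, hw, hvw⟩ => hT u v hv ⟨w, hST hw, hvw⟩⟩
    · rintro S T ⟨κ₁, hκ₁, ε₁, hε₁, hS⟩ ⟨κ₂, hκ₂, ε₂, hε₂, hT⟩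
      refine ⟨max κ₁ κ₂, lt_max_of_lt_left hκ₁, min ε₁ ε₂, lt_min hε₁ hε₂, ?_⟩
      rintro u v hv ⟨w, hw | hw, hvw⟩
      · exact (hS u v hv ⟨w, hw, hvw.trans (min_le_left _ _)⟩).trans
          (mul_le_mul_of_nonneg_right (le_max_left _ _) (norm_nonneg _))
      · exact (hT u v hv ⟨w, hw, hvw.trans (min_le_right _ _)⟩).trans
          (mul_le_mul_of_nonneg_right (le_max_right _ _) (norm_nonneg _))
    · intro x hx
      obtain ⟨-, κ, hκ, ε, hε, hcalm⟩ := h x hx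
      refine ⟨Metric.ball x (ε / 2),
        mem_nhdsWithin_of_mem_nhds (Metric.ball_mem_nhds x (half_pos hε)),
        κ, hκ, ε / 2, half_pos hε, ?_⟩
      rintro u v hv ⟨w, hw, hvw⟩
      rw [mem_ball_iff_norm] at hw
      exact hcalm u v hv (by linarith [norm_sub_le_norm_sub_add_norm_sub v w x])
  · rintro ⟨κ, hκ, ε, hε, h⟩ x hx
    exact ⟨hVsub hx, κ, hκ, ε, hε, fun u v hv hvx => h u v hv ⟨x, hx, hvx⟩⟩
end

section
/- Let m ≤ n and G ∈ ℝ^{m×n}. Suppose −G = U·D·Vᵀ, where U ∈ ℝ^{m×m} and V ∈ ℝ^{n×n} are orthogonal, and D ∈ ℝ^{m×n} is the block matrix with diagonal blocks I_s (the s×s identity), Σ (an (r−s)×(r−s) diagonal matrix all of whose diagonal entries lie strictly between 0 and 1), and zeros elsewhere, for some integers 0 ≤ s ≤ r ≤ m. Then {X ∈ ℝ^{m×n} : −G ∈ ∂‖X‖_*} = {U·[Z 0; 0 0]·Vᵀ : Z ∈ ℝ^{s×s} symmetric positive semidefinite}, where [Z 0; 0 0] denotes the m×n matrix with Z in its top-left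 s×s block and zeros elsewhere. -/
open Matrix
open scoped NNReal

-- matrices are equipped with the Frobenius norm throughout
attribute [local instance] Matrix.frobeniusNormedAddCommGroup

/-- The nuclear norm of a real matrix: the sum of its singular values, i.e. of the
square roots of the eigenvalues of `X * Xᵀ`. -/
noncomputable def nuclearNorm {m n : ℕ} (X : Matrix (Fin m) (Fin n) ℝ) : ℝ :=
  ∑ i, Real.sqrt ((Matrix.isHermitian_mul_conjTranspose_self X).eigenvalues i)

/-- The trace (Frobenius) inner product `⟨G, X⟩ = trace (Gᵀ * X)` on real matrices. -/
noncomputable def frobInner {m n : ℕ} (G X : Matrix (Fin m) (Fin n) ℝ) : ℝ :=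
  ∑ i, ∑ j, G i j * X i j

/-- The subdifferential of the nuclear norm with respect to the trace inner product. -/
def nucSubdiff {m n : ℕ} (X : Matrix (Fin m) (Fin n) ℝ) : Set (Matrix (Fin m) (Fin n) ℝ) :=
  {G : Matrix (Fin m) (Fin n) ℝ | ∀ Z : Matrix (Fin m) (Fin n) ℝ,
    nuclearNorm X + frobInner G (Z - X) ≤ nuclearNorm Z}

lemma frobInner_eq_trace {m n : ℕ} (G X : Matrix (Fin m) (Fin n) ℝ) :
    frobInner G X = (X * Gᵀ).trace := by
  simp [frobInner, Matrix.trace, Matrix.mul_apply, mul_comm]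

lemma frobInner_sub {m n : ℕ} (G X Y : Matrix (Fin m) (Fin n) ℝ) :
    frobInner G (X - Y) = frobInner G X - frobInner G Y := by
  simp [frobInner, mul_sub, Finset.sum_sub_distrib]

lemma exists_orthogonal_diagonalization {m n : ℕ} (X : Matrix (Fin m) (Fin n) ℝ) :
    ∃ (W : Matrix (Fin m) (Fin m) ℝ) (t : Fin m → ℝ), Wᵀ * W = 1 ∧ W * Wᵀ = 1 ∧
      (∀ i, 0 ≤ t i) ∧ X * Xᵀ = W * diagonal (fun i => t i ^ 2) * Wᵀ ∧
      nuclearNorm X = ∑ i, t i := by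
  have hX := Matrix.isHermitian_mul_conjTranspose_self X
  refine ⟨hX.eigenvectorUnitary, fun i => Real.sqrt (hX.eigenvalues i), ?_, ?_,
    fun i => Real.sqrt_nonneg _, ?_, rfl⟩
  · exact (Matrix.mem_unitaryGroup_iff').1 hX.eigenvectorUnitary.2
  · exact (Matrix.mem_unitaryGroup_iff).1 hX.eigenvectorUnitary.2
  · have h0 := (Matrix.posSemidef_self_mul_conjTranspose X).eigenvalues_nonneg
    have h := hX.spectral_theorem
    rw [Unitary.conjStarAlgAut_apply] at h
    simp only [Real.sq_sqrt (h0 _)]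
    exact h

/-- The nuclear norm is the trace of the positive semidefinite square root
of `X * Xᵀ`. -/
lemma nuclearNorm_eq_trace_of_mul_self_eq {m n : ℕ} (X : Matrix (Fin m) (Fin n) ℝ)
    (P : Matrix (Fin m) (Fin m) ℝ) (hP : P.PosSemidef) (h : P * P = X * Xᵀ) :
    nuclearNorm X = P.trace := by
  obtain ⟨W, t, hW, hW', ht, hX, hn⟩ := exists_orthogonal_diagonalization X
  have hQ : (W * diagonal t * Wᵀ).PosSemidef := by
    have := (PosSemidef.diagonal (d := t) ht).mul_mul_conjTranspose_same W
    rwa [conjTranspose_eq_transpose_of_trivial] at this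
  have hQQ : (W * diagonal t * Wᵀ) * (W * diagonal t * Wᵀ) = X * Xᵀ := by
    rw [hX]
    calc _ = W * diagonal t * (Wᵀ * W) * diagonal t * Wᵀ := by simp only [Matrix.mul_assoc]
      _ = _ := by rw [hW, Matrix.mul_one, Matrix.mul_assoc W, diagonal_mul_diagonal]; simp [sq]
  have hPQ : P = W * diagonal t * Wᵀ := by
    open scoped MatrixOrder in
    rw [← CFC.sqrt_unique h hP.nonneg, CFC.sqrt_unique hQQ hQ.nonneg]
  rw [hPQ, hn, Matrix.trace_mul_comm, ← Matrix.mul_assoc, hW, Matrix.one_mul, trace_diagonal]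

lemma mul_sum_eq_of_sum_sq {ι : Type*} (s : Finset ι) (k y : ι → ℝ) (t : ℝ) :
    2 * (t * ∑ j ∈ s, k j * y j) =
      t ^ 2 * ∑ j ∈ s, k j ^ 2 + ∑ j ∈ s, y j ^ 2 - ∑ j ∈ s, (y j - t * k j) ^ 2 := by
  simp only [Finset.mul_sum, ← Finset.sum_add_distrib, ← Finset.sum_sub_distrib]
  exact Finset.sum_congr rfl fun _ _ => by ring

lemma sum_mul_le_of_sum_sq {ι : Type*} (s : Finset ι) (k y : ι → ℝ) (t : ℝ) (ht : 0 ≤ t)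
    (hk : ∑ j ∈ s, k j ^ 2 ≤ 1) (hy : ∑ j ∈ s, y j ^ 2 = t ^ 2) :
    ∑ j ∈ s, k j * y j ≤ t := by
  have h := Finset.sum_mul_sq_le_sq_mul_sq s k y
  rw [hy] at h
  exact abs_le_of_sq_le_sq' (by nlinarith [sq_nonneg t]) ht |>.2

lemma eq_mul_of_sum_mul_eq {ι : Type*} (s : Finset ι) (k y : ι → ℝ) (t : ℝ)
    (hk : ∑ j ∈ s, k j ^ 2 ≤ 1) (hy : ∑ j ∈ s, y j ^ 2 = t ^ 2)
    (h : ∑ j ∈ s, k j * y j = t) : ∀ j ∈ s, y j = t * k j := by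
  have h1 := mul_sum_eq_of_sum_sq s k y t
  rw [hy, h] at h1
  have h0 : ∀ j ∈ s, 0 ≤ (y j - t * k j) ^ 2 := fun j _ => sq_nonneg _
  have h2 : ∑ j ∈ s, (y j - t * k j) ^ 2 = 0 :=
    le_antisymm (by nlinarith [sq_nonneg t]) (Finset.sum_nonneg h0)
  intro j hj
  have := (Finset.sum_eq_zero_iff_of_nonneg h0).1 h2 j hj
  exact sub_eq_zero.1 (pow_eq_zero_iff two_ne_zero |>.1 this)

lemma mul_transpose_self_apply_self {m n : ℕ} (A : Matrix (Fin m) (Fin n) ℝ) (i : Fin m) :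
    (A * Aᵀ) i i = ∑ j, A i j ^ 2 := by
  simp [Matrix.mul_apply, sq]

lemma sum_sq_row_le_one {m n : ℕ} {H : Matrix (Fin m) (Fin n) ℝ}
    (hH : (1 - H * Hᵀ).PosSemidef) {W : Matrix (Fin m) (Fin m) ℝ} (hW : Wᵀ * W = 1)
    (i : Fin m) : ∑ j, (Wᵀ * H) i j ^ 2 ≤ 1 := by
  have h := (hH.conjTranspose_mul_mul_same W).diag_nonneg (i := i)
  rw [conjTranspose_eq_transpose_of_trivial, Matrix.mul_sub, Matrix.sub_mul, Matrix.mul_one, hW,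
    show Wᵀ * (H * Hᵀ) * W = (Wᵀ * H) * (Wᵀ * H)ᵀ by
      simp [Matrix.transpose_mul, Matrix.mul_assoc], Matrix.sub_apply, Matrix.one_apply_eq,
    mul_transpose_self_apply_self] at h
  linarith

lemma sum_sq_row_eq {m n : ℕ} {X : Matrix (Fin m) (Fin n) ℝ} {W : Matrix (Fin m) (Fin m) ℝ}
    {t : Fin m → ℝ} (hW : Wᵀ * W = 1) (hX : X * Xᵀ = W * diagonal (fun i => t i ^ 2) * Wᵀ)
    (i : Fin m) : ∑ j, (Wᵀ * X) i j ^ 2 = t i ^ 2 := by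
  rw [← mul_transpose_self_apply_self,
    show (Wᵀ * X) * (Wᵀ * X)ᵀ = Wᵀ * (X * Xᵀ) * W by
      simp [Matrix.transpose_mul, Matrix.mul_assoc], hX,
    show Wᵀ * (W * diagonal (fun i => t i ^ 2) * Wᵀ) * W =
      (Wᵀ * W) * diagonal (fun i => t i ^ 2) * (Wᵀ * W) by simp only [Matrix.mul_assoc], hW]
  simp

lemma frobInner_eq_sum_rows {m n : ℕ} (H X : Matrix (Fin m) (Fin n) ℝ)
    {W : Matrix (Fin m) (Fin m) ℝ} (hW' : W * Wᵀ = 1) :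
    frobInner H X = ∑ i, ∑ j, (Wᵀ * H) i j * (Wᵀ * X) i j := by
  change _ = frobInner (Wᵀ * H) (Wᵀ * X)
  rw [frobInner_eq_trace, frobInner_eq_trace]
  calc (X * Hᵀ).trace = ((W * Wᵀ) * (X * Hᵀ)).trace := by rw [hW', Matrix.one_mul]
    _ = (Wᵀ * (X * Hᵀ) * W).trace := by rw [Matrix.mul_assoc, Matrix.trace_mul_comm]
    _ = _ := by simp only [Matrix.transpose_mul, transpose_transpose, Matrix.mul_assoc]

/-- Duality between the nuclear norm and the spectral norm. -/
lemma frobInner_le_nuclearNorm {m n : ℕ} {H : Matrix (Fin m) (Fin n) ℝ}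
    (hH : (1 - H * Hᵀ).PosSemidef) (X : Matrix (Fin m) (Fin n) ℝ) :
    frobInner H X ≤ nuclearNorm X := by
  obtain ⟨W, t, hW, hW', ht, hX, hn⟩ := exists_orthogonal_diagonalization X
  rw [hn, frobInner_eq_sum_rows H X hW']
  exact Finset.sum_le_sum fun i _ => sum_mul_le_of_sum_sq _ _ _ _ (ht i)
    (sum_sq_row_le_one hH hW i) (sum_sq_row_eq hW hX i)

/-- The equality case of `frobInner_le_nuclearNorm`. -/
lemma exists_posSemidef_of_nuclearNorm_eq {m n : ℕ} {H : Matrix (Fin m) (Fin n) ℝ}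
    (hH : (1 - H * Hᵀ).PosSemidef) {X : Matrix (Fin m) (Fin n) ℝ}
    (h : frobInner H X = nuclearNorm X) :
    ∃ P : Matrix (Fin m) (Fin m) ℝ, P.PosSemidef ∧ X = P * H ∧ P * P = X * Xᵀ := by
  obtain ⟨W, t, hW, hW', ht, hX, hn⟩ := exists_orthogonal_diagonalization X
  rw [hn, frobInner_eq_sum_rows H X hW'] at h
  have h1 := (Finset.sum_eq_sum_iff_of_le fun i _ => sum_mul_le_of_sum_sq _ _ _ _ (ht i)
    (sum_sq_row_le_one hH hW i) (sum_sq_row_eq hW hX i)).1 h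
  have h2 : Wᵀ * X = diagonal t * (Wᵀ * H) := by
    ext i j
    rw [diagonal_mul]
    exact eq_mul_of_sum_mul_eq _ _ _ _ (sum_sq_row_le_one hH hW i) (sum_sq_row_eq hW hX i)
      (h1 i (Finset.mem_univ i)) j (Finset.mem_univ j)
  refine ⟨W * diagonal t * Wᵀ, ?_, ?_, ?_⟩
  · have := (PosSemidef.diagonal (d := t) ht).mul_mul_conjTranspose_same W
    rwa [conjTranspose_eq_transpose_of_trivial] at this
  · rw [Matrix.mul_assoc, Matrix.mul_assoc, ← h2, ← Matrix.mul_assoc, hW', Matrix.one_mul]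
  · rw [hX]
    calc _ = W * diagonal t * (Wᵀ * W) * diagonal t * Wᵀ := by simp only [Matrix.mul_assoc]
      _ = _ := by rw [hW, Matrix.mul_one, Matrix.mul_assoc W, diagonal_mul_diagonal]; simp [sq]

lemma nuclearNorm_zero {m n : ℕ} : nuclearNorm (0 : Matrix (Fin m) (Fin n) ℝ) = 0 := by
  rw [nuclearNorm_eq_trace_of_mul_self_eq 0 0 PosSemidef.zero (by simp), trace_zero]

/-- For `H` in the spectral unit ball, `H ∈ ∂‖X‖_*` means that `X` attains the dual pairing. -/
lemma mem_nucSubdiff_iff {m n : ℕ} {H : Matrix (Fin m) (Fin n) ℝ}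
    (hH : (1 - H * Hᵀ).PosSemidef) {X : Matrix (Fin m) (Fin n) ℝ} :
    H ∈ nucSubdiff X ↔ frobInner H X = nuclearNorm X := by
  constructor
  · intro h
    have h0 := h 0
    rw [nuclearNorm_zero, frobInner_sub, show frobInner H 0 = 0 by simp [frobInner]] at h0
    linarith [frobInner_le_nuclearNorm hH X]
  · intro h Z
    rw [frobInner_sub, h]
    linarith [frobInner_le_nuclearNorm hH Z]

/-- The matrix with `Z` in its top-left `s × s` block and zeros elsewhere. -/
def topLeftBlock {s : ℕ} (m n : ℕ) (Z : Matrix (Fin s) (Fin s) ℝ) : Matrix (Fin m) (Fin n) ℝ :=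
  Matrix.of fun i j => if hij : (i : ℕ) < s ∧ (j : ℕ) < s then Z ⟨i, hij.1⟩ ⟨j, hij.2⟩ else 0

lemma topLeftBlock_posSemidef {s m : ℕ} {Z : Matrix (Fin s) (Fin s) ℝ} (hZ : Z.PosSemidef) :
    (topLeftBlock m m Z).PosSemidef := by
  have h := hZ.conjTranspose_mul_mul_same
    (Matrix.of fun (a : Fin s) (i : Fin m) => if (i : ℕ) = a then (1 : ℝ) else 0)
  convert h using 1
  have key : ∀ (i : Fin m) (f : Fin s → ℝ), ∑ a : Fin s, f a * (if (i : ℕ) = a then 1 else 0) =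
      if hi : (i : ℕ) < s then f ⟨i, hi⟩ else 0 := by
    intro i f
    split_ifs with hi
    · rw [Finset.sum_eq_single ⟨i, hi⟩]
      · simp
      · intro b _ hb
        rw [if_neg fun h => hb (Fin.ext h.symm), mul_zero]
      · simp
    · exact Finset.sum_eq_zero fun a _ => by rw [if_neg (by omega), mul_zero]
  ext i j
  simp only [topLeftBlock, of_apply, Matrix.mul_apply, conjTranspose_apply, star_trivial, key,
    mul_comm (if _ then (1 : ℝ) else 0)]
  split_ifs <;> first | rfl | omega

lemma topLeftBlock_mul_of_diagonal {s m n : ℕ} (hsm : s ≤ m) (Z : Matrix (Fin s) (Fin s) ℝ)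
    {σ : Fin m → ℝ} (hσ : ∀ i : Fin m, (i : ℕ) < s → σ i = 1)
    {D : Matrix (Fin m) (Fin n) ℝ}
    (hD : ∀ (i : Fin m) (j : Fin n), D i j = if (j : ℕ) = (i : ℕ) then σ i else 0) :
    topLeftBlock m m Z * D = topLeftBlock m n Z := by
  ext i j
  rw [Matrix.mul_apply]
  by_cases hj : (j : ℕ) < s
  · rw [Finset.sum_eq_single ⟨j, hj.trans_le hsm⟩]
    · rw [hD, if_pos rfl, hσ _ hj, mul_one]
      rfl
    · intro b _ hb
      rw [hD, if_neg fun h => hb (Fin.ext h.symm), mul_zero]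
    · simp
  · rw [Finset.sum_eq_zero]
    · simp [topLeftBlock, hj]
    · intro k _
      rw [hD]
      split_ifs with h
      · simp [topLeftBlock, ← h, hj]
      · simp

lemma mul_transpose_of_diagonal {m n : ℕ} (hmn : m ≤ n) {σ : Fin m → ℝ}
    {D : Matrix (Fin m) (Fin n) ℝ}
    (hD : ∀ (i : Fin m) (j : Fin n), D i j = if (j : ℕ) = (i : ℕ) then σ i else 0) :
    D * Dᵀ = diagonal fun i => σ i ^ 2 := by
  ext i k
  rw [Matrix.mul_apply, Finset.sum_eq_single (Fin.castLE hmn i)]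
  · by_cases h : i = k
    · subst h
      simp [hD, sq]
    · simp [hD, h, Fin.val_ne_of_ne h]
  · intro b _ hb
    have hbi : (b : ℕ) ≠ i := fun h => hb (Fin.ext h)
    simp [hD, hbi]
  · simp

lemma topLeftBlock_mul_diagonal {s m : ℕ} (Z : Matrix (Fin s) (Fin s) ℝ) {d : Fin m → ℝ}
    (hd : ∀ i : Fin m, (i : ℕ) < s → d i = 1) :
    topLeftBlock m m Z * diagonal d = topLeftBlock m m Z := by
  ext i j
  rw [mul_diagonal]
  by_cases hj : (j : ℕ) < s
  · rw [hd j hj, mul_one]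
  · simp [topLeftBlock, hj]

lemma apply_eq_zero_of_mul_diagonal_mul_self_eq_zero {m : ℕ} {P : Matrix (Fin m) (Fin m) ℝ}
    (hP : Pᵀ = P) {d : Fin m → ℝ} (hd : ∀ i, 0 ≤ d i) (h : P * diagonal d * P = 0)
    {k : Fin m} (hk : 0 < d k) (i : Fin m) : P i k = 0 := by
  have h1 : ∑ j, d j * P i j ^ 2 = 0 := by
    have := congrFun (congrFun h i) i
    rw [Matrix.mul_apply] at this
    rw [← Matrix.zero_apply i i, ← this]
    refine Finset.sum_congr rfl fun j _ => ?_
    rw [mul_diagonal, show P j i = P i j from congrFun (congrFun hP i) j]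
    ring
  have h2 := (Finset.sum_eq_zero_iff_of_nonneg
    fun j _ => mul_nonneg (hd j) (sq_nonneg (P i j))).1 h1 k (Finset.mem_univ k)
  simpa [hk.ne'] using h2

/-- If `-G = U·D·Vᵀ` is an SVD of `-G` in which the first `s`
singular values equal `1`, the next `r - s` lie strictly in `(0, 1)`, and the rest
vanish, then `{X : -G ∈ ∂‖X‖_*}` consists exactly of the matrices
`U·[Z 0; 0 0]·Vᵀ` with `Z` an `s × s` symmetric positive semidefinite matrix. -/
theorem nuclear_norm_subdiff_inverse_characterization
    (m n : ℕ) (hmn : m ≤ n) (s r : ℕ) (hsr : s ≤ r) (hrm : r ≤ m)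
    (G : Matrix (Fin m) (Fin n) ℝ)
    (U : Matrix (Fin m) (Fin m) ℝ) (V : Matrix (Fin n) (Fin n) ℝ)
    (hU : Uᵀ * U = 1) (hU' : U * Uᵀ = 1)
    (hV : Vᵀ * V = 1) (hV' : V * Vᵀ = 1)
    (σ : Fin m → ℝ)
    (hσ1 : ∀ i : Fin m, (i : ℕ) < s → σ i = 1)
    (hσ2 : ∀ i : Fin m, s ≤ (i : ℕ) → (i : ℕ) < r → 0 < σ i ∧ σ i < 1)
    (hσ3 : ∀ i : Fin m, r ≤ (i : ℕ) → σ i = 0)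
    (D : Matrix (Fin m) (Fin n) ℝ)
    (hD : ∀ (i : Fin m) (j : Fin n), D i j = if (j : ℕ) = (i : ℕ) then σ i else 0)
    (hG : -G = U * D * Vᵀ) :
    {X : Matrix (Fin m) (Fin n) ℝ | -G ∈ nucSubdiff X} =
      {X : Matrix (Fin m) (Fin n) ℝ | ∃ Z : Matrix (Fin s) (Fin s) ℝ, Z.PosSemidef ∧
        X = U * (Matrix.of fun (i : Fin m) (j : Fin n) =>
          if hij : (i : ℕ) < s ∧ (j : ℕ) < s then Z ⟨i, hij.1⟩ ⟨j, hij.2⟩ else 0) * Vᵀ} := by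
  have hsm : s ≤ m := hsr.trans hrm
  have hσ : ∀ i : Fin m, 0 ≤ 1 - σ i ^ 2 := by
    intro i
    rcases lt_or_ge (i : ℕ) s with h | h
    · simp [hσ1 i h]
    rcases lt_or_ge (i : ℕ) r with h' | h'
    · nlinarith [hσ2 i h h']
    · simp [hσ3 i h']
  have hσ' : ∀ i : Fin m, s ≤ (i : ℕ) → 0 < 1 - σ i ^ 2 := by
    intro i h
    rcases lt_or_ge (i : ℕ) r with h' | h'
    · nlinarith [hσ2 i h h']
    · simp [hσ3 i h']
  have hDD := mul_transpose_of_diagonal hmn hD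
  have hHH : -G * (-G)ᵀ = U * diagonal (fun i => σ i ^ 2) * Uᵀ := by
    rw [hG, ← hDD]
    calc _ = U * D * (Vᵀ * V) * Dᵀ * Uᵀ := by
          simp only [Matrix.transpose_mul, transpose_transpose, Matrix.mul_assoc]
      _ = _ := by rw [hV, Matrix.mul_one]; simp only [Matrix.mul_assoc]
  have hdiag : 1 - -G * (-G)ᵀ = U * diagonal (fun i => 1 - σ i ^ 2) * Uᵀ := by
    rw [hHH, ← diagonal_sub, Matrix.mul_sub, Matrix.sub_mul, diagonal_one, Matrix.mul_one, hU']
  have hH : (1 - -G * (-G)ᵀ).PosSemidef := by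
    have := (PosSemidef.diagonal (d := fun i => 1 - σ i ^ 2) hσ).mul_mul_conjTranspose_same U
    rwa [conjTranspose_eq_transpose_of_trivial, ← hdiag] at this
  ext X
  rw [Set.mem_ofPred_eq, Set.mem_ofPred_eq, mem_nucSubdiff_iff hH]
  change _ ↔ ∃ Z : Matrix (Fin s) (Fin s) ℝ, Z.PosSemidef ∧ X = U * topLeftBlock m n Z * Vᵀ
  constructor
  · intro h
    obtain ⟨P, hP, hX, hPP⟩ := exists_posSemidef_of_nuclearNorm_eq hH h
    have hPt : Pᵀ = P := hP.isHermitian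
    have hQ : (Uᵀ * P * U).PosSemidef := by
      have := hP.conjTranspose_mul_mul_same U
      rwa [conjTranspose_eq_transpose_of_trivial] at this
    set Q := Uᵀ * P * U with hQdef
    have hQt : Qᵀ = Q := hQ.isHermitian
    have hPQ : P = U * Q * Uᵀ := by
      calc P = (U * Uᵀ) * P * (U * Uᵀ) := by rw [hU', Matrix.one_mul, Matrix.mul_one]
        _ = _ := by simp only [hQdef, Matrix.mul_assoc]
    have hzero : P * (1 - -G * (-G)ᵀ) * P = 0 := by
      rw [Matrix.mul_sub, Matrix.sub_mul, Matrix.mul_one, hPP, sub_eq_zero]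
      conv_lhs => rw [hX, Matrix.transpose_mul, hPt]
      simp only [Matrix.mul_assoc]
    have hQ0 : Q * diagonal (fun i => 1 - σ i ^ 2) * Q = 0 := by
      calc _ = Uᵀ * (P * (U * diagonal (fun i => 1 - σ i ^ 2) * Uᵀ) * P) * U := by
            simp only [hQdef, Matrix.mul_assoc]
        _ = 0 := by rw [← hdiag, hzero, Matrix.mul_zero, Matrix.zero_mul]
    have hQk : ∀ i k : Fin m, s ≤ (k : ℕ) → Q i k = 0 := fun i k hk =>
      apply_eq_zero_of_mul_diagonal_mul_self_eq_zero hQt hσ hQ0 (hσ' k hk) i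
    have hQk' : ∀ i k : Fin m, s ≤ (i : ℕ) → Q i k = 0 := fun i k hi => by
      rw [← hQt, transpose_apply, hQk k i hi]
    have hQZ : topLeftBlock m m (Q.submatrix (Fin.castLE hsm) (Fin.castLE hsm)) = Q := by
      ext i j
      simp only [topLeftBlock, of_apply]
      split_ifs with hij
      · rfl
      · rcases not_and_or.1 hij with h | h
        · rw [hQk' i j (not_lt.1 h)]
        · rw [hQk i j (not_lt.1 h)]
    refine ⟨Q.submatrix (Fin.castLE hsm) (Fin.castLE hsm), hQ.submatrix _, ?_⟩
    rw [← topLeftBlock_mul_of_diagonal hsm _ hσ1 hD, hQZ, hX, hG, hPQ]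
    calc _ = U * Q * (Uᵀ * U) * D * Vᵀ := by simp only [Matrix.mul_assoc]
      _ = _ := by rw [hU, Matrix.mul_one]; simp only [Matrix.mul_assoc]
  · rintro ⟨Z, hZ, hX⟩
    have hQ := topLeftBlock_posSemidef (m := m) hZ
    have hQD := topLeftBlock_mul_of_diagonal hsm Z hσ1 hD
    have hQσ := topLeftBlock_mul_diagonal (m := m) Z (d := fun i => σ i ^ 2)
      fun i hi => by simp [hσ1 i hi]
    set Q := topLeftBlock m m Z
    have hQt : Qᵀ = Q := hQ.isHermitian
    have hP : (U * Q * Uᵀ).PosSemidef := by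
      have := hQ.mul_mul_conjTranspose_same U
      rwa [conjTranspose_eq_transpose_of_trivial] at this
    have hPt : (U * Q * Uᵀ)ᵀ = U * Q * Uᵀ := hP.isHermitian
    have hXP : X = U * Q * Uᵀ * -G := by
      rw [hX, ← hQD, hG]
      calc _ = U * Q * 1 * D * Vᵀ := by simp only [Matrix.mul_assoc, Matrix.mul_one]
        _ = _ := by rw [← hU]; simp only [Matrix.mul_assoc]
    have hPHH : U * Q * Uᵀ * (-G * (-G)ᵀ) = U * Q * Uᵀ := by
      rw [hHH]
      calc _ = U * (Q * (Uᵀ * U) * diagonal (fun i => σ i ^ 2)) * Uᵀ := by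
            simp only [Matrix.mul_assoc]
        _ = _ := by rw [hU, Matrix.mul_one, hQσ]
    have hPP : (U * Q * Uᵀ) * (U * Q * Uᵀ) = X * Xᵀ := by
      rw [hXP, Matrix.transpose_mul, hPt, Matrix.mul_assoc _ (-G), ← Matrix.mul_assoc (-G),
        ← Matrix.mul_assoc _ (-G * (-G)ᵀ), hPHH]
    rw [nuclearNorm_eq_trace_of_mul_self_eq X _ hP hPP, frobInner_eq_trace, hXP,
      Matrix.mul_assoc _ (-G), hPHH]
end

section
/- Let f : ℝ^{2×2} → ℝ be given by f(X) = (3/4)X₁₁² − 2X₁₁X₂₂ + (3/2)X₂₂² − (5/2)X₁₁ + X₂₂, let P(X) = ‖X‖_*, let R(X) = prox_P(X − ∇f(X)) − X, and let X̄ be the matrix with X̄₁₁ = 1 and all other entries 0 (the unique minimizer of F = f + P). For each δ ∈ (0, 1], let X_δ ∈ ℝ^{2×2} be the matrix with entries (X_δ)₁₁ = 1 + 2δ², (X_δ)₁₂ = (X_δ)₂₁ = δ, (X_δ)₂₂ = δ². Then R(X_δ) is the diagonal matrix diag(−δ², δ²) and ‖X_δ − X̄‖_F ≥ δ. Consequently,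 there do not exist constants κ, ε > 0 such that ‖X − X̄‖_F ≤ κ‖R(X)‖_F for all X ∈ ℝ^{2×2} with ‖R(X)‖_F ≤ ε; i.e., the Lipschitzian error bound with residual ‖R(·)‖_F fails for this problem. -/
open Matrix
open scoped NNReal

-- matrices are equipped with the Frobenius norm throughout
attribute [local instance] Matrix.frobeniusNormedAddCommGroup

/-- The squared nuclear norm of a `2 × 2` matrix is `‖Z‖_F² + 2 |det Z|`. -/
lemma nuclearNorm_sq_fin_two (Z : Matrix (Fin 2) (Fin 2) ℝ) :
    nuclearNorm Z ^ 2 =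
      Z 0 0 ^ 2 + Z 0 1 ^ 2 + Z 1 0 ^ 2 + Z 1 1 ^ 2 + 2 * |Z 0 0 * Z 1 1 - Z 0 1 * Z 1 0| := by
  have hH := Matrix.isHermitian_mul_conjTranspose_self Z
  have h0 := (Matrix.posSemidef_self_mul_conjTranspose Z).eigenvalues_nonneg
  have htr := hH.trace_eq_sum_eigenvalues
  have hdet := hH.det_eq_prod_eigenvalues
  simp only [Fin.sum_univ_two, Fin.prod_univ_two, Matrix.trace_fin_two, Matrix.det_mul,
    Matrix.det_conjTranspose, Matrix.mul_apply, Matrix.conjTranspose_apply, star_trivial,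
    RCLike.ofReal_real_eq_id, id] at htr hdet
  have hroot : √(hH.eigenvalues 0) * √(hH.eigenvalues 1) =
      |Z 0 0 * Z 1 1 - Z 0 1 * Z 1 0| := by
    rw [← Real.sqrt_mul (h0 0), ← hdet, Real.sqrt_mul_self_eq_abs, Matrix.det_fin_two]
  rw [nuclearNorm, Fin.sum_univ_two, add_sq, Real.sq_sqrt (h0 0), Real.sq_sqrt (h0 1),
    mul_assoc, hroot]
  linarith

lemma nuclearNorm_nonneg {m n : ℕ} (X : Matrix (Fin m) (Fin n) ℝ) : 0 ≤ nuclearNorm X :=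
  Finset.sum_nonneg fun _ _ => Real.sqrt_nonneg _

lemma trace_le_nuclearNorm_fin_two (Z : Matrix (Fin 2) (Fin 2) ℝ) :
    Z.trace ≤ nuclearNorm Z := by
  refine le_of_sq_le_sq ?_ (nuclearNorm_nonneg Z)
  rw [nuclearNorm_sq_fin_two, Matrix.trace_fin_two]
  nlinarith [le_abs_self (Z 0 0 * Z 1 1 - Z 0 1 * Z 1 0), sq_nonneg (Z 0 1 - Z 1 0)]

lemma nuclearNorm_eq_trace_fin_two {a b c : ℝ} (htr : 0 ≤ a + c) (hdet : 0 ≤ a * c - b * b) :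
    nuclearNorm !![a, b; b, c] = a + c := by
  refine (sq_eq_sq₀ (nuclearNorm_nonneg _) htr).1 ?_
  rw [nuclearNorm_sq_fin_two]
  simp only [Matrix.of_apply, Matrix.cons_val', Matrix.cons_val_zero, Matrix.cons_val_one,
    Matrix.cons_val_fin_one, abs_of_nonneg hdet]
  ring

lemma one_mem_nucSubdiff_fin_two {a b c : ℝ} (htr : 0 ≤ a + c) (hdet : 0 ≤ a * c - b * b) :
    1 ∈ nucSubdiff !![a, b; b, c] := by
  intro Z
  have h := trace_le_nuclearNorm_fin_two Z
  rw [Matrix.trace_fin_two] at h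
  rw [nuclearNorm_eq_trace_fin_two htr hdet]
  simp [frobInner, Fin.sum_univ_two]
  linarith

lemma frobenius_norm_fin_two (A : Matrix (Fin 2) (Fin 2) ℝ) :
    ‖A‖ = √(A 0 0 ^ 2 + A 0 1 ^ 2 + A 1 0 ^ 2 + A 1 1 ^ 2) := by
  rw [Matrix.frobenius_norm_def, Real.sqrt_eq_rpow]
  simp [Fin.sum_univ_two, add_assoc]

/-- For the problem `min f + ‖·‖_*` on `ℝ^{2×2}` with
`∇f X = diag((3/2) X₁₁ − 2 X₂₂ − 5/2, −2 X₁₁ + 3 X₂₂ + 1)` and unique minimizer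
`X̄ = [[1, 0], [0, 0]]`, the matrices `X_δ = [[1 + 2δ², δ], [δ, δ²]]` satisfy
`R X_δ = diag(−δ², δ²)` and `‖X_δ − X̄‖_F ≥ δ` for `δ ∈ (0, 1]`; consequently no
Lipschitzian error bound `‖X − X̄‖_F ≤ κ ‖R X‖_F` (for `‖R X‖_F ≤ ε`) can hold. -/
theorem counterexample_error_bound_fails
    (gradf : Matrix (Fin 2) (Fin 2) ℝ → Matrix (Fin 2) (Fin 2) ℝ)
    (hgradf : ∀ X : Matrix (Fin 2) (Fin 2) ℝ,
      gradf X = !![(3/2) * X 0 0 - 2 * X 1 1 - 5/2, 0; 0, -2 * X 0 0 + 3 * X 1 1 + 1])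
    -- the proximal map of the nuclear norm and the residual map
    (prox : Matrix (Fin 2) (Fin 2) ℝ → Matrix (Fin 2) (Fin 2) ℝ)
    (hprox : ∀ V U : Matrix (Fin 2) (Fin 2) ℝ, U = prox V ↔ V - U ∈ nucSubdiff U)
    (Rm : Matrix (Fin 2) (Fin 2) ℝ → Matrix (Fin 2) (Fin 2) ℝ)
    (hRm : ∀ X : Matrix (Fin 2) (Fin 2) ℝ, Rm X = prox (X - gradf X) - X) :
    (∀ δ : ℝ, 0 < δ → δ ≤ 1 →
      Rm !![1 + 2 * δ ^ 2, δ; δ, δ ^ 2] = !![-δ ^ 2, 0; 0, δ ^ 2] ∧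
      δ ≤ ‖(!![1 + 2 * δ ^ 2, δ; δ, δ ^ 2] - !![(1 : ℝ), 0; 0, 0] :
        Matrix (Fin 2) (Fin 2) ℝ)‖) ∧
    ¬ ∃ κ : ℝ, 0 < κ ∧ ∃ ε : ℝ, 0 < ε ∧ ∀ X : Matrix (Fin 2) (Fin 2) ℝ,
        ‖Rm X‖ ≤ ε → ‖X - !![(1 : ℝ), 0; 0, 0]‖ ≤ κ * ‖Rm X‖ := by
  have key : ∀ δ : ℝ, 0 < δ →
      Rm !![1 + 2 * δ ^ 2, δ; δ, δ ^ 2] = !![-δ ^ 2, 0; 0, δ ^ 2] ∧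
      δ ≤ ‖(!![1 + 2 * δ ^ 2, δ; δ, δ ^ 2] - !![(1 : ℝ), 0; 0, 0] :
        Matrix (Fin 2) (Fin 2) ℝ)‖ := by
    intro δ hδ
    constructor
    · have hU : !![1 + δ ^ 2, δ; δ, 2 * δ ^ 2] =
          prox (!![1 + 2 * δ ^ 2, δ; δ, δ ^ 2] - gradf !![1 + 2 * δ ^ 2, δ; δ, δ ^ 2]) := by
        rw [hprox]
        convert one_mem_nucSubdiff_fin_two (a := 1 + δ ^ 2) (b := δ) (c := 2 * δ ^ 2)
          (by positivity) (by nlinarith [sq_nonneg δ, sq_nonneg (δ ^ 2)]) using 1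
        rw [hgradf]
        ext i j
        fin_cases i <;> fin_cases j <;> simp <;> ring
      rw [hRm, ← hU]
      ext i j
      fin_cases i <;> fin_cases j <;> simp <;> ring
    · rw [frobenius_norm_fin_two]
      apply Real.le_sqrt_of_sq_le
      simp
      nlinarith [sq_nonneg (δ ^ 2), sq_nonneg δ]
  refine ⟨fun δ hδ _ => key δ hδ, ?_⟩
  rintro ⟨κ, hκ, ε, hε, hbound⟩
  obtain ⟨δ, hδ, hδ_lt⟩ : ∃ δ : ℝ, 0 < δ ∧ δ < min 1 (min (ε / 2) (1 / (2 * κ))) :=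
    exists_between (by positivity)
  simp only [lt_min_iff] at hδ_lt
  obtain ⟨hδ_one, hδε, hδκ⟩ := hδ_lt
  rw [lt_div_iff₀ (by positivity)] at hδκ
  obtain ⟨hR, hdist⟩ := key δ hδ
  have hnorm : ‖(!![-δ ^ 2, 0; 0, δ ^ 2] : Matrix (Fin 2) (Fin 2) ℝ)‖ ≤ 2 * δ ^ 2 := by
    rw [frobenius_norm_fin_two]
    refine Real.sqrt_le_iff.2 ⟨by positivity, ?_⟩
    simp
    nlinarith [sq_nonneg (δ ^ 2)]
  have h := hbound !![1 + 2 * δ ^ 2, δ; δ, δ ^ 2] (by rw [hR]; nlinarith)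
  rw [hR] at h
  nlinarith [mul_le_mul_of_nonneg_left hnorm hκ.le]
end
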